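/- Let n ≥ 1, let α, γ₀ ∈ ℝ, let f : ℝ → ℝ, and write Δf(k) = f(k+1) − f(k). Let g be a graph on {1,…,n} and let i, j be distinct non-adjacent vertices of g. Then q_i(g + ij) − q_i(g) = −(n/(n+1))·Δf(η_i(g)) + (1/(n+1))·Δf(η_j(g)), and the profit change satisfies the exact identity Y_i(g + ij) − Y_i(g) = q_i(g)·(2/(n+1))·(Δf(η_j(g)) − n·Δf(η_i(g))) + (1/(n+1))²·(Δf(η_j(g)) − n·Δf(η_i(g)))². -/

import Mathlib

open Finset

/-- The degree of vertex `i` in the simple graph `g`. -/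
noncomputable def deg {n : ℕ} (g : SimpleGraph (Fin n)) (i : Fin n) : ℕ :=
  Nat.card (g.neighborSet i)

/-- The graph obtained from `g` by deleting the link `ij`. -/
def delLink {n : ℕ} (g : SimpleGraph (Fin n)) (i j : Fin n) : SimpleGraph (Fin n) :=
  g.deleteEdges {s(i, j)}

/-- The graph obtained from `g` by adding the link `ij`. -/
def addLink {n : ℕ} (g : SimpleGraph (Fin n)) (i j : Fin n) : SimpleGraph (Fin n) :=
  g ⊔ SimpleGraph.fromEdgeSet {s(i, j)}

theorem addLink_comm {n : ℕ} (g : SimpleGraph (Fin n)) (i j : Fin n) :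
    addLink g i j = addLink g j i := by
  simp only [addLink, Sym2.eq_swap]

theorem deg_addLink_left {n : ℕ} (g : SimpleGraph (Fin n)) {i j : Fin n} (hij : i ≠ j)
    (hnadj : ¬ g.Adj i j) : deg (addLink g i j) i = deg g i + 1 := by
  have h : (addLink g i j).neighborSet i = insert j (g.neighborSet i) := by
    ext k
    simp only [addLink, SimpleGraph.mem_neighborSet, SimpleGraph.sup_adj,
      SimpleGraph.fromEdgeSet_adj, Set.mem_singleton_iff, Sym2.eq_iff, Set.mem_insert_iff]
    grind
  rw [deg, deg, h, Nat.card_coe_set_eq, Nat.card_coe_set_eq]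
  exact Set.ncard_insert_of_notMem hnadj

theorem deg_addLink_right {n : ℕ} (g : SimpleGraph (Fin n)) {i j : Fin n} (hij : i ≠ j)
    (hnadj : ¬ g.Adj i j) : deg (addLink g i j) j = deg g j + 1 := by
  rw [addLink_comm]
  exact deg_addLink_left g hij.symm fun h => hnadj h.symm

theorem deg_addLink_of_ne {n : ℕ} (g : SimpleGraph (Fin n)) {i j k : Fin n} (hi : k ≠ i)
    (hj : k ≠ j) : deg (addLink g i j) k = deg g k := by
  have h : (addLink g i j).neighborSet k = g.neighborSet k := by
    ext l
    simp only [addLink, SimpleGraph.mem_neighborSet, SimpleGraph.sup_adj,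
      SimpleGraph.fromEdgeSet_adj, Set.mem_singleton_iff, Sym2.eq_iff]
    grind
  rw [deg, deg, h]

/-- Adding the link `ij` changes the sum of costs of the rivals of `i` only through firm `j`. -/
theorem sum_erase_deg_addLink {n : ℕ} (f : ℝ → ℝ) (g : SimpleGraph (Fin n)) {i j : Fin n}
    (hij : i ≠ j) (hnadj : ¬ g.Adj i j) :
    ∑ k ∈ univ.erase i, f (deg (addLink g i j) k : ℝ) =
      ∑ k ∈ univ.erase i, f (deg g k : ℝ) + (f ((deg g j : ℝ) + 1) - f (deg g j : ℝ)) := by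
  have hj : j ∈ univ.erase i := mem_erase.mpr ⟨hij.symm, mem_univ j⟩
  have hrest : ∑ k ∈ (univ.erase i).erase j, f (deg (addLink g i j) k : ℝ) =
      ∑ k ∈ (univ.erase i).erase j, f (deg g k : ℝ) := by
    refine sum_congr rfl fun k hk => ?_
    simp only [mem_erase, mem_univ, and_true] at hk
    rw [deg_addLink_of_ne g hk.2 hk.1]
  rw [← add_sum_erase _ _ hj, ← add_sum_erase _ _ hj, hrest, deg_addLink_right g hij hnadj]
  push_cast
  ring

/-- In the Cournot equilibrium with cost vector `γ₀ + x`, the markup of each firm equals its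
quantity. -/
theorem cournot_markup_eq_quantity {n : ℕ} (α γ₀ : ℝ) (x q : Fin n → ℝ)
    (hq : ∀ i, q i = (α - γ₀ - n * x i + ∑ j ∈ univ.erase i, x j) / (n + 1)) (i : Fin n) :
    α - ∑ j, q j - (γ₀ + x i) = q i := by
  have hn : (n : ℝ) + 1 ≠ 0 := by positivity
  have hq' : ∀ k, q k = (α - γ₀ + ∑ j, x j) / (n + 1) - x k := by
    intro k
    rw [hq, ← add_sum_erase univ x (mem_univ k)]
    field_simp
    ring
  have hsum : ∑ k, q k = n * ((α - γ₀ + ∑ j, x j) / (n + 1)) - ∑ k, x k := by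
    simp [hq', sum_sub_distrib]
  rw [hsum, hq']
  field_simp
  ring

theorem stmt_15 (n : ℕ) (hn : 1 ≤ n) (α γ₀ : ℝ) (f : ℝ → ℝ)
    (q : SimpleGraph (Fin n) → Fin n → ℝ)
    (hq : ∀ g i, q g i = (α - γ₀ - n * f (deg g i : ℝ)
      + ∑ j ∈ univ.erase i, f (deg g j : ℝ)) / (n + 1))
    (P : SimpleGraph (Fin n) → ℝ) (hP : ∀ g, P g = α - ∑ j, q g j)
    (c : SimpleGraph (Fin n) → Fin n → ℝ)
    (hc : ∀ g i, c g i = γ₀ + f (deg g i : ℝ))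
    (Y : Fin n → SimpleGraph (Fin n) → ℝ)
    (hY : ∀ i g, Y i g = q g i * (P g - c g i))
    (Δf : ℕ → ℝ) (hΔf : ∀ m : ℕ, Δf m = f ((m : ℝ) + 1) - f (m : ℝ))
    (g : SimpleGraph (Fin n)) (i j : Fin n) (hij : i ≠ j) (hnadj : ¬ g.Adj i j) :
    q (addLink g i j) i - q g i =
      -((n : ℝ) / ((n : ℝ) + 1)) * Δf (deg g i) + (1 / ((n : ℝ) + 1)) * Δf (deg g j) ∧
    Y i (addLink g i j) - Y i g =
      q g i * (2 / ((n : ℝ) + 1)) * (Δf (deg g j) - n * Δf (deg g i)) +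
        (1 / ((n : ℝ) + 1)) ^ 2 * (Δf (deg g j) - n * Δf (deg g i)) ^ 2 := by
  have hn' : (n : ℝ) + 1 ≠ 0 := by positivity
  have hquant : q (addLink g i j) i - q g i =
      -((n : ℝ) / ((n : ℝ) + 1)) * Δf (deg g i) + (1 / ((n : ℝ) + 1)) * Δf (deg g j) := by
    rw [hq, hq, sum_erase_deg_addLink f g hij hnadj, deg_addLink_left g hij hnadj, hΔf, hΔf]
    push_cast
    field_simp
    ring
  have hprofit : ∀ h, Y i h = q h i ^ 2 := by
    intro h
    rw [hY, hP, hc,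
      cournot_markup_eq_quantity α γ₀ (fun k => f (deg h k : ℝ)) (q h) (hq h) i, sq]
  refine ⟨hquant, ?_⟩
  rw [hprofit, hprofit, eq_add_of_sub_eq hquant]
  field_simp
  ring
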